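/- In the reduction from Exact Cover: if R ⊆ F is such that ⋂R contains no Z-variable and exactly m − n Y-variables, then the family H_R = {A_i | ∃ F_j ∈ R, ∃ ℓ, s_ℓ ∈ A_i and Y_{i,ℓ} ∉ F_j (i.e., some event in R excludes a Y-variable with first index i)} is an exact cover of S: its members are pairwise disjoint and their union is S. -/

import Mathlib

inductive World (n k : ℕ) : Type where
  | W : World n k
  | X : World n k
  | Y : Fin k → Fin n → World n k
  | Z : Fin n → World n k
  deriving DecidableEq, Fintype

/-- The event `F_i`: excludes `Y i l` and `Z l` for every `l ∈ A i`. -/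
def Fev {n k : ℕ} (A : Fin k → Finset (Fin n)) (i : Fin k) : Set (World n k) :=
  {w | match w with
       | .Y j l => ¬ (j = i ∧ l ∈ A i)
       | .Z l => l ∉ A i
       | _ => True}

open scoped Classical in
/-- Number of (valid) `Y`-variables belonging to a set of worlds. -/
noncomputable def Ycount {n k : ℕ} (A : Fin k → Finset (Fin n))
    (T : Set (World n k)) : ℕ :=
  (Finset.univ.filter
    (fun p : Fin k × Fin n => p.2 ∈ A p.1 ∧ World.Y p.1 p.2 ∈ T)).card

open scoped Classical in
/-- Number of `Z`-variables belonging to a set of worlds. -/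
noncomputable def Zcount {n k : ℕ} (T : Set (World n k)) : ℕ :=
  (Finset.univ.filter (fun l : Fin n => World.Z l ∈ T)).card

/-- The probability function of the reduction (`x = 1/3`). -/
noncomputable def prob {n k : ℕ} (A : Fin k → Finset (Fin n)) (y z : ℝ) :
    World n k → ℝ
  | .W => 1/3
  | .X => 1/3
  | .Y i l => if l ∈ A i then y else 0
  | .Z _ => z

/-- The additive extension of a probability function to sets of worlds. -/
noncomputable def pstar {n k : ℕ} (π : World n k → ℝ) (S : Set (World n k)) : ℝ :=
  ∑ w : World n k, Set.indicator S π w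

/-- The goal event `E = {W₀} ∪ Y`. -/
def goal {n k : ℕ} : Set (World n k) :=
  {w | w = World.W ∨ ∃ (i : Fin k) (l : Fin n), w = World.Y i l}

/-- The family `H_R`: indices `i` such that some event in `R` excludes a
`Y`-variable with first index `i`. -/
def HR {n k : ℕ} (A : Fin k → Finset (Fin n)) (R : Set (Fin k)) : Set (Fin k) :=
  {i | ∃ j ∈ R, ∃ l : Fin n, l ∈ A i ∧ World.Y i l ∉ Fev A j}

theorem Y_mem_iInter_Fev {n k : ℕ} {A : Fin k → Finset (Fin n)} {R : Set (Fin k)}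
    {i : Fin k} {l : Fin n} (hl : l ∈ A i) :
    World.Y i l ∈ ⋂ j ∈ R, Fev A j ↔ i ∉ R := by
  simp only [Set.mem_iInter, Fev, Set.mem_ofPred_eq]
  constructor
  · intro h hi
    exact h i hi ⟨rfl, hl⟩
  · rintro hi j hj ⟨rfl, -⟩
    exact hi hj

theorem Z_mem_iInter_Fev {n k : ℕ} {A : Fin k → Finset (Fin n)} {R : Set (Fin k)}
    {l : Fin n} : World.Z l ∈ ⋂ j ∈ R, Fev A j ↔ ∀ j ∈ R, l ∉ A j := by
  simp [Fev]

theorem HR_eq {n k : ℕ} {A : Fin k → Finset (Fin n)} (hne : ∀ i, (A i).Nonempty)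
    (R : Set (Fin k)) : HR A R = R := by
  ext i
  constructor
  · rintro ⟨j, hj, l, -, h⟩
    obtain ⟨rfl, -⟩ : i = j ∧ l ∈ A j := not_not.mp h
    exact hj
  · intro hi
    obtain ⟨l, hl⟩ := hne i
    exact ⟨i, hi, l, hl, fun h => h ⟨rfl, hl⟩⟩

theorem card_incidences {n k : ℕ} (A : Fin k → Finset (Fin n)) :
    (Finset.univ.filter (fun p : Fin k × Fin n => p.2 ∈ A p.1)).card = ∑ i, (A i).card := by
  rw [← Finset.card_sigma]
  refine Finset.card_bij' (fun p _ => ⟨p.1, p.2⟩) (fun p _ => (p.1, p.2)) ?_ ?_ ?_ ?_ <;> simp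

theorem le_sum_card_of_cover {n k : ℕ} {A : Fin k → Finset (Fin n)}
    (hcov : ∀ l, ∃ i, l ∈ A i) : n ≤ ∑ i, (A i).card := by
  calc n = (Finset.univ.biUnion A).card := by
        rw [(Finset.eq_univ_iff_forall (s := Finset.univ.biUnion A)).mpr (by simpa using hcov),
          Finset.card_univ, Fintype.card_fin]
    _ ≤ _ := Finset.card_biUnion_le

open scoped Classical in
theorem Ycount_add_card_excluded {n k : ℕ} (A : Fin k → Finset (Fin n)) (R : Set (Fin k)) :
    Ycount A (⋂ i ∈ R, Fev A i) +
      (Finset.univ.filter (fun p : Fin k × Fin n => p.2 ∈ A p.1 ∧ p.1 ∈ R)).card =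
      ∑ i, (A i).card := by
  rw [← card_incidences, Ycount, add_comm,
    ← Finset.card_filter_add_card_filter_not
      (s := Finset.univ.filter fun p : Fin k × Fin n => p.2 ∈ A p.1) (fun p : Fin k × Fin n => p.1 ∈ R),
    Finset.filter_filter, Finset.filter_filter]
  congr 2
  ext p
  simp only [Finset.mem_filter, Finset.mem_univ, true_and]
  exact and_congr_right Y_mem_iInter_Fev

theorem stmt_9 (n k : ℕ) (A : Fin k → Finset (Fin n))
    (hcov : ∀ l : Fin n, ∃ i : Fin k, l ∈ A i)
    (hne : ∀ i : Fin k, (A i).Nonempty)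
    (hinj : Function.Injective A)
    (R : Set (Fin k))
    (hZ : ∀ l : Fin n, World.Z l ∉ ⋂ i ∈ R, Fev A i)
    (hY : Ycount A (⋂ i ∈ R, Fev A i) = (∑ i : Fin k, (A i).card) - n) :
    (∀ i ∈ HR A R, ∀ j ∈ HR A R, i ≠ j → Disjoint (A i) (A j)) ∧
      (∀ l : Fin n, ∃ i ∈ HR A R, l ∈ A i) := by
  classical
  rw [HR_eq hne]
  have hR : ∀ l, ∃ i ∈ R, l ∈ A i := fun l => by
    simpa using mt Z_mem_iInter_Fev.mpr (hZ l)
  refine ⟨fun i hi j hj hij => ?_, hR⟩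
  have hcard : (Finset.univ.filter
      (fun p : Fin k × Fin n => p.2 ∈ A p.1 ∧ p.1 ∈ R)).card = n := by
    have hsum := Ycount_add_card_excluded A R
    have hle := le_sum_card_of_cover hcov
    omega
  have hinjOn := Finset.injOn_of_surjOn_of_card_le
    (s := Finset.univ.filter fun p : Fin k × Fin n => p.2 ∈ A p.1 ∧ p.1 ∈ R)
    (t := Finset.univ) Prod.snd
    (fun _ _ => by simp)
    (fun l _ => by
      obtain ⟨i, hi, hl⟩ := hR l
      exact ⟨(i, l), by simp [hi, hl], rfl⟩)
    (by rw [hcard, Finset.card_univ, Fintype.card_fin])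
  refine Finset.disjoint_left.mpr fun l hli hlj => hij ?_
  exact congrArg Prod.fst
    (@hinjOn (i, l) (by simp [hi, hli]) (j, l) (by simp [hj, hlj]) rfl)
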